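/- arXiv:1207.4921 — 2 statements merged into one kernel-verified Lean document; each statement's English description precedes it below -/
import Mathlib

section
/- Let A = (a_{i,j})_{i,j∈I} be an indecomposable generalized Cartan matrix and ρ: I → Ī an admissible quotient map with fibers Γ_s = ρ⁻¹({s}). Then the matrix Ā = (ā_{s,t})_{s,t∈Ī}, where ā_{s,t} = Σ_{i∈Γ_s} a_{i,j} for any j∈Γ_t when s≠t and ā_{s,s} = 2, is an indecomposable generalized Cartan matrix. -/
attribute [local instance] Classical.propDecidable

noncomputable section

namespace KMG

open Module

/-! ### Generalized Cartan matrices -/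

/-- `A` is a generalized Cartan matrix. -/
def IsGCM {I : Type*} (A : Matrix I I ℤ) : Prop :=
  (∀ i, A i i = 2) ∧ (∀ i j, i ≠ j → A i j ≤ 0) ∧ ∀ i j, A i j = 0 → A j i = 0

/-- `A` is indecomposable. -/
def Indecomposable {I : Type*} (A : Matrix I I ℤ) : Prop :=
  ∀ s : Set I, s.Nonempty → sᶜ.Nonempty → ∃ i ∈ s, ∃ j ∈ sᶜ, A i j ≠ 0

/-- `A` is symmetrizable: `D A` is symmetric for an invertible diagonal matrix `D`. -/
def Symmetrizable {I : Type*} (A : Matrix I I ℤ) : Prop :=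
  ∃ d : I → ℚ, (∀ i, d i ≠ 0) ∧ ∀ i j, d i * (A i j : ℚ) = d j * (A j i : ℚ)

/-- The principal submatrix of `A` indexed by a subset `S`. -/
def restrictM {I : Type*} (A : Matrix I I ℤ) (S : Set I) : Matrix S S ℤ :=
  fun i j => A i.1 j.1

/-- `A` is of finite type: `A u > 0` for some `u > 0` (Kac, Thm. 4.3). -/
def IsFiniteType {I : Type*} (A : Matrix I I ℤ) : Prop :=
  ∃ u : I → ℚ, (∀ i, 0 < u i) ∧ ∀ i, 0 < ∑ᶠ j, (A i j : ℚ) * u j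

/-- `A` is of affine type: `A` indecomposable and `A u = 0` for some `u > 0`. -/
def IsAffineType {I : Type*} (A : Matrix I I ℤ) : Prop :=
  Indecomposable A ∧ ∃ u : I → ℚ, (∀ i, 0 < u i) ∧ ∀ i, ∑ᶠ j, (A i j : ℚ) * u j = 0

/-- `A` is of indefinite type: `A u < 0` for some `u > 0`. -/
def IsIndefiniteType {I : Type*} (A : Matrix I I ℤ) : Prop :=
  ∃ u : I → ℚ, (∀ i, 0 < u i) ∧ ∀ i, ∑ᶠ j, (A i j : ℚ) * u j < 0

/-- The corank of a generalized Cartan matrix. -/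
def gcmCorank {I : Type*} [Fintype I] [DecidableEq I] (A : Matrix I I ℤ) : ℕ :=
  Fintype.card I - (A.map ((↑) : ℤ → ℚ)).rank

/-- The connected component of the vertex `k` in the subdiagram of the Dynkin diagram of `A`
with vertex set `S`. -/
def cmpnt {I : Type*} (A : Matrix I I ℤ) (S : Set I) (k : I) : Set I :=
  {i | i ∈ S ∧ Relation.ReflTransGen (fun x y => x ∈ S ∧ y ∈ S ∧ A x y ≠ 0) k i}

/-- `A` is hyperbolic: deleting any one vertex of the Dynkin diagram leaves a disjoint union
of diagrams of finite or affine type. -/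
def IsHyperbolic {I : Type*} (A : Matrix I I ℤ) : Prop :=
  ∀ i₀ k : I, k ≠ i₀ →
    IsFiniteType (restrictM A (cmpnt A {i | i ≠ i₀} k)) ∨
      IsAffineType (restrictM A (cmpnt A {i | i ≠ i₀} k))

/-- `A` is Lorentzian: `A` is nonsingular and its symmetrization has signature `(+,...,+,-)`. -/
def IsLorentzian {I : Type*} [Fintype I] [DecidableEq I] (A : Matrix I I ℤ) : Prop :=
  IsUnit (A.map ((↑) : ℤ → ℚ)).det ∧
    ∃ d : I → ℚ, (∀ i, 0 < d i) ∧ (∀ i j, d i * (A i j : ℚ) = d j * (A j i : ℚ)) ∧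
      ∃ P : Matrix I I ℝ, IsUnit P.det ∧ ∃ i₀ : I,
        P.transpose * (Matrix.of fun i j => ((d i : ℝ) * (A i j : ℝ))) * P =
          Matrix.diagonal fun i => if i = i₀ then (-1 : ℝ) else 1

/-! ### Weight spaces -/

variable {g : Type*} [LieRing g] [LieAlgebra ℂ g]

/-- The weight space of weight `χ` for the adjoint action on `g` of a space `V` mapping to `g`
by `ι`. -/
def wtSpaceι {V : Type*} [AddCommGroup V] [Module ℂ V] (ι : V →ₗ[ℂ] g)
    (χ : Module.Dual ℂ V) : Submodule ℂ g where
  carrier := {x | ∀ v : V, ⁅ι v, x⁆ = χ v • x}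
  add_mem' := fun ha hb v => by rw [lie_add, ha v, hb v, smul_add]
  zero_mem' := fun v => by rw [lie_zero, smul_zero]
  smul_mem' := fun c x hx v => by rw [lie_smul, hx v, smul_comm]

/-! ### Kac-Moody algebras -/

/-- A (symmetrizable) Kac-Moody algebra structure on the Lie algebra `g`, for the generalized
Cartan matrix `A` indexed by `I` : a realization `(H, root, coroot)` of `A` together with
Chevalley generators `e i`, `f i` satisfying the Chevalley-Serre relations, such that `g` is
generated by `H` and the `e i, f i`, is diagonalizable under `H`, with `0`-weight space `H`. -/
structure KacMoodyAlgebra {I : Type*} [Fintype I] [DecidableEq I] (A : Matrix I I ℤ)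
    (g : Type*) [LieRing g] [LieAlgebra ℂ g] : Type _ where
  H : Submodule ℂ g
  root : I → Module.Dual ℂ H
  coroot : I → H
  e : I → g
  f : I → g
  findimH : FiniteDimensional ℂ H
  finrankH : Module.finrank ℂ H = Fintype.card I + gcmCorank A
  indepRoot : LinearIndependent ℂ root
  indepCoroot : LinearIndependent ℂ coroot
  pairing : ∀ i j, root j (coroot i) = (A i j : ℂ)
  abelian : ∀ x y : H, ⁅(x : g), (y : g)⁆ = 0
  lie_e : ∀ (x : H) (i : I), ⁅(x : g), e i⁆ = root i x • e i
  lie_f : ∀ (x : H) (i : I), ⁅(x : g), f i⁆ = -(root i x) • f i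
  e_f : ∀ i j, ⁅e i, f j⁆ = if j = i then ((coroot i : g)) else 0
  serre_e : ∀ i j, i ≠ j →
    ((LieAlgebra.ad ℂ g (e i)) ^ (1 - A i j).toNat) (e j) = 0
  serre_f : ∀ i j, i ≠ j →
    ((LieAlgebra.ad ℂ g (f i)) ^ (1 - A i j).toNat) (f j) = 0
  generates : LieSubalgebra.lieSpan ℂ g ((H : Set g) ∪ Set.range e ∪ Set.range f) = ⊤
  weight_decomp : ⨆ χ : Module.Dual ℂ H, wtSpaceι H.subtype χ = ⊤
  zero_weight : wtSpaceι H.subtype (0 : Module.Dual ℂ H) = H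

variable {I : Type*} [Fintype I] [DecidableEq I] {A : Matrix I I ℤ}

/-- The root system of a Kac-Moody algebra: nonzero weights of the adjoint action of the
Cartan subalgebra. -/
def Delta (G : KacMoodyAlgebra A g) : Set (Module.Dual ℂ G.H) :=
  {χ | χ ≠ 0 ∧ wtSpaceι G.H.subtype χ ≠ ⊥}

/-- The positive roots with respect to the standard root basis. -/
def posRoots (G : KacMoodyAlgebra A g) : Set (Module.Dual ℂ G.H) :=
  {χ ∈ Delta G | ∃ c : I → ℕ, χ = ∑ i, (c i : ℂ) • G.root i}

/-- The real roots : the orbit of the simple roots under the Weyl group. -/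
inductive IsRealRoot (G : KacMoodyAlgebra A g) : Module.Dual ℂ G.H → Prop
  | simple (i : I) : IsRealRoot G (G.root i)
  | reflect (i : I) (χ : Module.Dual ℂ G.H) :
      IsRealRoot G χ → IsRealRoot G (χ - χ (G.coroot i) • G.root i)

/-- The subalgebra `g(S)` generated by the root spaces `g_{± α_i}`, `i ∈ S`. -/
def gS (G : KacMoodyAlgebra A g) (S : Set I) : LieSubalgebra ℂ g :=
  LieSubalgebra.lieSpan ℂ g ({x | ∃ i ∈ S, x = G.e i} ∪ {x | ∃ i ∈ S, x = G.f i})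

/-- The subspace `h^J = {h ∈ h | ⟨α_j, h⟩ = 0 ∀ j ∈ J}`. -/
def hJsub (G : KacMoodyAlgebra A g) (J : Set I) : Submodule ℂ G.H :=
  ⨅ j ∈ J, LinearMap.ker (G.root j)

/-- `Hk` is the canonical semisimple element attached to `k` and the component `S = I_k` :
it lies in the span of the coroots from `S` and satisfies `⟨α_i, H_k⟩ = 2 δ_{i,k}` on `S`. -/
def IsHGen (G : KacMoodyAlgebra A g) (S : Set I) (k : I) (Hk : G.H) : Prop :=
  Hk ∈ Submodule.span ℂ (G.coroot '' S) ∧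
    ∀ i ∈ S, G.root i Hk = if i = k then 2 else 0

/-- `g(S)` is `A₁`-graded by the `sl₂`-triple with semisimple element `Hk` :
`ad Hk` has only eigenvalues `0, 2, -2` on `g(S)`. -/
def A1GradedBy (G : KacMoodyAlgebra A g) (S : Set I) (Hk : g) : Prop :=
  ∀ x ∈ gS G S, x ∈ Module.End.eigenspace (LieAlgebra.ad ℂ g Hk) 0 ⊔
    Module.End.eigenspace (LieAlgebra.ad ℂ g Hk) 2 ⊔
      Module.End.eigenspace (LieAlgebra.ad ℂ g Hk) (-2)

/-- The pair `(I_k, J_k)` (for `I_k` the connected component of `k` in `J ∪ {k}`) is an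
irreducible `C`-admissible pair. -/
def CAdmissibleComponent (G : KacMoodyAlgebra A g) (J : Set I) (k : I) : Prop :=
  IsFiniteType (restrictM A (cmpnt A (J ∪ {k}) k)) ∧
    ∃ Hk : G.H, IsHGen G (cmpnt A (J ∪ {k}) k) k Hk ∧
      ∃ E F : g, E ∈ gS G (cmpnt A (J ∪ {k}) k) ∧ F ∈ gS G (cmpnt A (J ∪ {k}) k) ∧
        IsSl2Triple (Hk : g) E F ∧ A1GradedBy G (cmpnt A (J ∪ {k}) k) (Hk : g)

/-- The data of a `C`-admissible pair `(I, J)` : for each `k ∉ J`, the component `I_k` is of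
finite type and carries an `sl₂`-triple `(E_k, H_k, F_k)` which `A₁`-grades `g(I_k)`. -/
structure CAdmissibleData (G : KacMoodyAlgebra A g) (J : Set I) : Type _ where
  finJ : IsFiniteType (restrictM A J)
  Hc : {k : I // k ∉ J} → G.H
  E : {k : I // k ∉ J} → g
  F : {k : I // k ∉ J} → g
  finIk : ∀ k : {k : I // k ∉ J}, IsFiniteType (restrictM A (cmpnt A (J ∪ {k.1}) k.1))
  isHGen : ∀ k, IsHGen G (cmpnt A (J ∪ {k.1}) k.1) k.1 (Hc k)
  memE : ∀ k, E k ∈ gS G (cmpnt A (J ∪ {k.1}) k.1)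
  memF : ∀ k, F k ∈ gS G (cmpnt A (J ∪ {k.1}) k.1)
  sl2 : ∀ k, IsSl2Triple ((Hc k : g)) (E k) (F k)
  a1 : ∀ k, A1GradedBy G (cmpnt A (J ∪ {k.1}) k.1) ((Hc k : g))

/-- `(I,J)` is a `C`-admissible pair. -/
def CAdmissiblePair (G : KacMoodyAlgebra A g) (J : Set I) : Prop :=
  Nonempty (CAdmissibleData G J)

/-- The data of a `C`-admissible pair `(Itot, J)` for a subdiagram `Itot ⊆ I`. -/
structure CAdmissibleDataIn (G : KacMoodyAlgebra A g) (Itot J : Set I) : Type _ where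
  subJ : J ⊆ Itot
  finJ : IsFiniteType (restrictM A J)
  Hc : {k : I // k ∈ Itot ∧ k ∉ J} → G.H
  E : {k : I // k ∈ Itot ∧ k ∉ J} → g
  F : {k : I // k ∈ Itot ∧ k ∉ J} → g
  finIk : ∀ k : {k : I // k ∈ Itot ∧ k ∉ J},
    IsFiniteType (restrictM A (cmpnt A (J ∪ {k.1}) k.1))
  isHGen : ∀ k, IsHGen G (cmpnt A (J ∪ {k.1}) k.1) k.1 (Hc k)
  memE : ∀ k, E k ∈ gS G (cmpnt A (J ∪ {k.1}) k.1)
  memF : ∀ k, F k ∈ gS G (cmpnt A (J ∪ {k.1}) k.1)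
  sl2 : ∀ k, IsSl2Triple ((Hc k : g)) (E k) (F k)
  a1 : ∀ k, A1GradedBy G (cmpnt A (J ∪ {k.1}) k.1) ((Hc k : g))

/-- The `C`-admissible subalgebra `g^J` : generated by `h^J` and the `E_k, F_k`. -/
def CAdmissibleData.gJ {G : KacMoodyAlgebra A g} {J : Set I} (D : CAdmissibleData G J) :
    LieSubalgebra ℂ g :=
  LieSubalgebra.lieSpan ℂ g
    ((((hJsub G J).map G.H.subtype : Submodule ℂ g) : Set g) ∪ Set.range D.E ∪ Set.range D.F)

/-- `GJ` is "the" Kac-Moody structure on `g^J` associated to a `C`-admissible pair: its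
Cartan subalgebra is `h^J`, its coroots are the `H_k` and its Chevalley generators are the
`E_k, F_k`; the matrix `A'` is `A^J`, i.e. `a'_{k,l} = ⟨α_l, H_k⟩`. -/
def CAdmissibleData.IsAssocKM {G : KacMoodyAlgebra A g} {J : Set I} (D : CAdmissibleData G J)
    {A' : Matrix {k : I // k ∉ J} {k : I // k ∉ J} ℤ}
    (GJ : KacMoodyAlgebra A' ↥D.gJ) : Prop :=
  (∀ k l, (A' k l : ℂ) = G.root l.1 (D.Hc k)) ∧
  GJ.H.map D.gJ.toSubmodule.subtype = (hJsub G J).map G.H.subtype ∧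
  (∀ k, ((GJ.coroot k : ↥D.gJ) : g) = ((D.Hc k : ↥G.H) : g)) ∧
  (∀ k, ((GJ.e k : ↥D.gJ) : g) = D.E k) ∧ (∀ k, ((GJ.f k : ↥D.gJ) : g) = D.F k)

/-! ### Finite gradations -/

/-- `g` is finitely `Σ`-graded, where `Σ` is the root system of the Kac-Moody algebra `m`
(with Kac-Moody structure `M`) and `m` is embedded in `g` by `φ` (the grading subalgebra is
the image of `φ`): `g` is the sum of the weight spaces `V_γ`, `γ ∈ Σ ∪ {0}`, of the adjoint
action of the Cartan subalgebra of `m`, and each `V_γ` is finite dimensional. -/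
def IsFinGrading {S : Type*} [Fintype S] [DecidableEq S] {B : Matrix S S ℤ}
    {m : Type*} [LieRing m] [LieAlgebra ℂ m] (M : KacMoodyAlgebra B m)
    (φ : m →ₗ⁅ℂ⁆ g) : Prop :=
  Function.Injective φ ∧
  (⨆ χ ∈ insert (0 : Module.Dual ℂ M.H) (Delta M),
      wtSpaceι (φ.toLinearMap ∘ₗ M.H.subtype) χ) = ⊤ ∧
  ∀ χ ∈ insert (0 : Module.Dual ℂ M.H) (Delta M),
      FiniteDimensional ℂ (wtSpaceι (φ.toLinearMap ∘ₗ M.H.subtype) χ)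

section Grading

variable {S : Type*} [Fintype S] [DecidableEq S] {B : Matrix S S ℤ}
variable {m : Type*} [LieRing m] [LieAlgebra ℂ m]

/-- The inclusion of the Cartan subalgebra of the grading subalgebra into the Cartan
subalgebra of `g` (given `a ⊆ h`). -/
def cartanIncl (G : KacMoodyAlgebra A g) (M : KacMoodyAlgebra B m) (φ : m →ₗ⁅ℂ⁆ g)
    (hle : M.H.map φ.toLinearMap ≤ G.H) : M.H →ₗ[ℂ] G.H :=
  LinearMap.codRestrict G.H (φ.toLinearMap ∘ₗ M.H.subtype)
    (fun x => hle (Submodule.mem_map_of_mem x.2))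

/-- The restriction `ρ_a(χ)` to the Cartan subalgebra `a` of `m` of a linear form `χ` on `h`. -/
def resD (G : KacMoodyAlgebra A g) (M : KacMoodyAlgebra B m) (φ : m →ₗ⁅ℂ⁆ g)
    (hle : M.H.map φ.toLinearMap ≤ G.H) (χ : Module.Dual ℂ G.H) : Module.Dual ℂ M.H :=
  χ.comp (cartanIncl G M φ hle)

/-- The restriction `ρ_a(α_i)` of the simple root `α_i` to `a`. -/
def resRoot (G : KacMoodyAlgebra A g) (M : KacMoodyAlgebra B m) (φ : m →ₗ⁅ℂ⁆ g)
    (hle : M.H.map φ.toLinearMap ≤ G.H) (i : I) : Module.Dual ℂ M.H :=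
  resD G M φ hle (G.root i)

/-- The root basis of `M` is adapted to the root basis of `G` :
`ρ_a(Δ⁺) ⊆ Σ⁺ ∪ {0}`. -/
def Adapted (G : KacMoodyAlgebra A g) (M : KacMoodyAlgebra B m) (φ : m →ₗ⁅ℂ⁆ g)
    (hle : M.H.map φ.toLinearMap ≤ G.H) : Prop :=
  ∀ χ ∈ posRoots G, resD G M φ hle χ = 0 ∨ resD G M φ hle χ ∈ posRoots M

/-- The set `J = {i ∈ I | ρ_a(α_i) = 0}`. -/
def Jof (G : KacMoodyAlgebra A g) (M : KacMoodyAlgebra B m) (φ : m →ₗ⁅ℂ⁆ g)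
    (hle : M.H.map φ.toLinearMap ≤ G.H) : Set I :=
  {i | resRoot G M φ hle i = 0}

/-- The set `Γ_s = {i ∈ I' | ρ_a(α_i) = γ_s}`. -/
def GammaOf (G : KacMoodyAlgebra A g) (M : KacMoodyAlgebra B m) (φ : m →ₗ⁅ℂ⁆ g)
    (hle : M.H.map φ.toLinearMap ≤ G.H) (s : S) : Set I :=
  {i | resRoot G M φ hle i = M.root s}

/-- The set `I'_re = {i ∈ I' | ρ_a(α_i) ∈ Π_a}`. -/
def IpRe (G : KacMoodyAlgebra A g) (M : KacMoodyAlgebra B m) (φ : m →ₗ⁅ℂ⁆ g)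
    (hle : M.H.map φ.toLinearMap ≤ G.H) : Set I :=
  {i | ∃ s : S, resRoot G M φ hle i = M.root s}

/-- The set `I'_im = {i ∈ I | ρ_a(α_i) ∉ Π_a ∪ {0}}`. -/
def IpIm (G : KacMoodyAlgebra A g) (M : KacMoodyAlgebra B m) (φ : m →ₗ⁅ℂ⁆ g)
    (hle : M.H.map φ.toLinearMap ≤ G.H) : Set I :=
  {i | resRoot G M φ hle i ≠ 0 ∧ ∀ s : S, resRoot G M φ hle i ≠ M.root s}

/-- The set `I_re` : union of the components `I_k`, `k ∈ I'_re`. -/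
def IreOf (G : KacMoodyAlgebra A g) (M : KacMoodyAlgebra B m) (φ : m →ₗ⁅ℂ⁆ g)
    (hle : M.H.map φ.toLinearMap ≤ G.H) : Set I :=
  {i | ∃ k ∈ IpRe G M φ hle, i ∈ cmpnt A (Jof G M φ hle ∪ {k}) k}

/-- `g` is maximally finitely graded: finitely graded, with `a ⊆ h`, the root basis of the
grading subalgebra adapted, and the corresponding sets `J` and `I'_im` empty. -/
def MaxFinGrading (G : KacMoodyAlgebra A g) (M : KacMoodyAlgebra B m) (φ : m →ₗ⁅ℂ⁆ g) : Prop :=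
  IsFinGrading M φ ∧ ∃ hle : M.H.map φ.toLinearMap ≤ G.H,
    Adapted G M φ hle ∧ Jof G M φ hle = ∅ ∧ IpIm G M φ hle = ∅

end Grading

/-- `(π, πv)` is a root basis (with generalized Cartan matrix `B`) of the root system `Rts`. -/
def IsRootBasis {V : Type*} [AddCommGroup V] [Module ℂ V] {S : Type*} [Fintype S]
    (B : Matrix S S ℤ) (Rts : Set (Module.Dual ℂ V)) (π : S → Module.Dual ℂ V)
    (πv : S → V) : Prop :=
  LinearIndependent ℂ π ∧ LinearIndependent ℂ πv ∧
  (∀ s t, π t (πv s) = (B s t : ℂ)) ∧ (∀ s, π s ∈ Rts) ∧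
  ∀ χ ∈ Rts, (∃ c : S → ℕ, χ = ∑ s, (c s : ℂ) • π s) ∨
    (∃ c : S → ℕ, χ = -∑ s, (c s : ℂ) • π s)

/-- `Bf` is a nondegenerate invariant symmetric bilinear form on `g`. -/
def InvariantForm (Bf : g →ₗ[ℂ] g →ₗ[ℂ] ℂ) : Prop :=
  (∀ x y, Bf x y = Bf y x) ∧ (∀ x y z, Bf ⁅x, y⁆ z = Bf x ⁅y, z⁆) ∧
  ∀ x, (∀ y, Bf x y = 0) → x = 0

/-- `Bf` is "the" invariant bilinear form of the Kac-Moody algebra `G` : nondegenerate,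
invariant, symmetric, with `(α_i∨, α_i∨)` a positive rational for all `i`. -/
def NormalizedInvForm (G : KacMoodyAlgebra A g) (Bf : g →ₗ[ℂ] g →ₗ[ℂ] ℂ) : Prop :=
  InvariantForm Bf ∧ ∀ i : I, ∃ q : ℚ, 0 < q ∧ Bf ((G.coroot i : g)) ((G.coroot i : g)) = (q : ℂ)

/-- `(e', f')` is a system of Chevalley generators for `G` (with the given Cartan subalgebra,
simple roots and coroots). -/
def IsChevalleyGens (G : KacMoodyAlgebra A g) (e' f' : I → g) : Prop :=
  (∀ (x : G.H) (i : I), ⁅(x : g), e' i⁆ = G.root i x • e' i) ∧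
  (∀ (x : G.H) (i : I), ⁅(x : g), f' i⁆ = -(G.root i x) • f' i) ∧
  (∀ i j, ⁅e' i, f' j⁆ = if j = i then ((G.coroot i : g)) else 0) ∧
  (∀ i j, i ≠ j → ((LieAlgebra.ad ℂ g (e' i)) ^ (1 - A i j).toNat) (e' j) = 0) ∧
  (∀ i j, i ≠ j → ((LieAlgebra.ad ℂ g (f' i)) ^ (1 - A i j).toNat) (f' j) = 0) ∧
  LieSubalgebra.lieSpan ℂ g ((G.H : Set g) ∪ Set.range e' ∪ Set.range f') = ⊤


/-- The subalgebra `g(I_re)` of `g` generated by `h_{I_re}` and the `e_i, f_i`, `i ∈ I_re`. -/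
def gIre (G : KacMoodyAlgebra A g) (Ire : Set I) (hIre : Submodule ℂ g) : LieSubalgebra ℂ g :=
  LieSubalgebra.lieSpan ℂ g
    ((hIre : Set g) ∪ {x | ∃ i ∈ Ire, x = G.e i} ∪ {x | ∃ i ∈ Ire, x = G.f i})

/-- `GI` is "the" Kac-Moody structure on `g(I_re)` : its Cartan subalgebra is `h_{I_re}`,
its coroots and Chevalley generators are the `α_i∨, e_i, f_i` of `g`, for `i ∈ I_re`. -/
def IsAssocKMIre (G : KacMoodyAlgebra A g) (Ire : Set I) (hIre : Submodule ℂ g)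
    {A'' : Matrix ↥Ire ↥Ire ℤ} (GI : KacMoodyAlgebra A'' ↥(gIre G Ire hIre)) : Prop :=
  GI.H.map (gIre G Ire hIre).toSubmodule.subtype = hIre ∧
  (∀ i, ((GI.coroot i : ↥(gIre G Ire hIre)) : g) = ((G.coroot i.1 : ↥G.H) : g)) ∧
  (∀ i, ((GI.e i : ↥(gIre G Ire hIre)) : g) = G.e i.1) ∧
  (∀ i, ((GI.f i : ↥(gIre G Ire hIre)) : g) = G.f i.1)

/-! ### Admissible quotients and maximal gradations -/

/-- `ρ : I → S` is an admissible quotient map for `A` : fibers are totally disconnected (MG1)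
and the column sums over a fiber are constant along fibers (MG2). -/
def AdmissibleQuotient {I S : Type*} (A : Matrix I I ℤ) (ρ : I → S) : Prop :=
  Function.Surjective ρ ∧
  (∀ k l, k ≠ l → ρ k = ρ l → A k l = 0) ∧
  ∀ s t : S, s ≠ t → ∀ j j', ρ j = t → ρ j' = t →
    ∑ᶠ i ∈ {i | ρ i = s}, A i j = ∑ᶠ i ∈ {i | ρ i = s}, A i j'

section Quotient

variable {S : Type*} [Fintype S] [DecidableEq S]

/-- `γ_s∨ = ∑_{k ∈ Γ_s} α_k∨`. -/
def gammaV (G : KacMoodyAlgebra A g) (ρ : I → S) (s : S) : G.H :=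
  ∑ᶠ k ∈ {k | ρ k = s}, G.coroot k

/-- `X̄_s = ∑_{k ∈ Γ_s} e_k`. -/
def Xbar (G : KacMoodyAlgebra A g) (ρ : I → S) (s : S) : g :=
  ∑ᶠ k ∈ {k | ρ k = s}, G.e k

/-- `Ȳ_s = ∑_{k ∈ Γ_s} f_k`. -/
def Ybar (G : KacMoodyAlgebra A g) (ρ : I → S) (s : S) : g :=
  ∑ᶠ k ∈ {k | ρ k = s}, G.f k

/-- The subalgebra `g^ρ` generated by `a` and the `X̄_s, Ȳ_s`. -/
def gRho (G : KacMoodyAlgebra A g) (ρ : I → S) (a : Submodule ℂ G.H) : LieSubalgebra ℂ g :=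
  LieSubalgebra.lieSpan ℂ g
    (((a.map G.H.subtype : Submodule ℂ g) : Set g) ∪ Set.range (Xbar G ρ) ∪
      Set.range (Ybar G ρ))

/-- `Gρ` is "the" Kac-Moody structure on `g^ρ` : its Cartan subalgebra is `a`, its coroots
are the `γ_s∨` and its Chevalley generators are the `X̄_s, Ȳ_s`. -/
def IsAssocKMrho (G : KacMoodyAlgebra A g) (ρ : I → S) (a : Submodule ℂ G.H)
    {Abar : Matrix S S ℤ} (Gρ : KacMoodyAlgebra Abar ↥(gRho G ρ a)) : Prop :=
  Gρ.H.map (gRho G ρ a).toSubmodule.subtype = a.map G.H.subtype ∧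
  (∀ s, ((Gρ.coroot s : ↥(gRho G ρ a)) : g) = ((gammaV G ρ s : ↥G.H) : g)) ∧
  (∀ s, ((Gρ.e s : ↥(gRho G ρ a)) : g) = Xbar G ρ s) ∧
  (∀ s, ((Gρ.f s : ↥(gRho G ρ a)) : g) = Ybar G ρ s)

end Quotient

end KMG


open KMG

section Statement

attribute [local instance] Classical.propDecidable


/-- A sum of nonpositive integers over a fiber of `ρ` is nonpositive, and vanishes exactly when
all its terms do. -/
theorem finsum_fiber_nonpos {I S : Type*} [Finite I] {f : I → ℤ} {ρ : I → S} {s : S}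
    (hf : ∀ i, ρ i = s → f i ≤ 0) :
    ∑ᶠ i ∈ {i | ρ i = s}, f i ≤ 0 ∧
      (∑ᶠ i ∈ {i | ρ i = s}, f i = 0 ↔ ∀ i, ρ i = s → f i = 0) := by
  have hfin : {i | ρ i = s}.Finite := Set.toFinite _
  rw [finsum_mem_eq_finite_toFinset_sum _ hfin]
  have hf' : ∀ i ∈ hfin.toFinset, f i ≤ 0 := fun i hi => hf i (by simpa using hi)
  exact ⟨Finset.sum_nonpos hf', by simp [Finset.sum_eq_zero_iff_of_nonpos hf']⟩

theorem statement17 {I' S' : Type*} [Fintype I'] [DecidableEq I'] [Fintype S'] [DecidableEq S']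
    (A : Matrix I' I' ℤ) (hGCM : IsGCM A) (hInd : Indecomposable A)
    (ρ : I' → S') (hadm : AdmissibleQuotient A ρ)
    (Abar : Matrix S' S' ℤ) (hdiag : ∀ s, Abar s s = 2)
    (hoff : ∀ s t, s ≠ t → ∀ j, ρ j = t → Abar s t = ∑ᶠ i ∈ {i | ρ i = s}, A i j) :
    IsGCM Abar ∧ Indecomposable Abar := by
  obtain ⟨hsurj, -, -⟩ := hadm
  obtain ⟨-, hneg, hsymm⟩ := hGCM
  have hfiber : ∀ s t, s ≠ t → ∀ j, ρ j = t →
      Abar s t ≤ 0 ∧ (Abar s t = 0 ↔ ∀ i, ρ i = s → A i j = 0) := by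
    intro s t hst j hj
    rw [hoff s t hst j hj]
    exact finsum_fiber_nonpos fun i hi => hneg i j (by rintro rfl; exact hst (hi.symm.trans hj))
  refine ⟨⟨hdiag, fun s t hst => ?_, fun s t h => ?_⟩, fun T hT hTc => ?_⟩
  · obtain ⟨j, hj⟩ := hsurj t
    exact (hfiber s t hst j hj).1
  · obtain rfl | hst := eq_or_ne s t
    · exact h
    · obtain ⟨i, hi⟩ := hsurj s
      exact (hfiber t s hst.symm i hi).2.2 fun j hj =>
        hsymm i j ((hfiber s t hst j hj).2.1 h i hi)
  · obtain ⟨i, hi, j, hj, hij⟩ :=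
      hInd (ρ ⁻¹' T) (hT.preimage hsurj) (hTc.preimage hsurj)
    refine ⟨ρ i, hi, ρ j, hj, fun h => hij ?_⟩
    exact (hfiber _ _ (fun e => hj (by simpa [← e] using hi)) j rfl).2.1 h i rfl

end Statement
end
end

section
/- Let g be the Kac-Moody algebra of an indecomposable symmetrizable generalized Cartan matrix A indexed by I, and ρ: I → Ī an admissible quotient map with fibers Γ_s. Set γ_s∨ = Σ_{k∈Γ_s} α_k∨, X̄_s = Σ_{k∈Γ_s} e_k, Ȳ_s = Σ_{k∈Γ_s} f_k, and let a ⊂ h^Γ = {h∈h : ⟨α_k,h⟩=⟨α_l,h⟩ whenever ρ(k)=ρ(l)} be a minimal realization subspace of Ā containing all γ_s∨, with γ_s the common restriction of the α_i (i∈Γ_s) to a. Then the subalgebra g^ρ of g generated by a and the X̄_s, Ȳ_s (s∈Ī) is the Kac-Moody algebra associated to the realization (a, {γ_s}, {γ_s∨}) of Ā; in particular the Serre relations (ad X̄_s)^{1−ā_{s,t}}(X̄_t) = 0 = (ad Ȳ_s)^{1−ā_{s,t}}(Ȳ_t) hold for s≠t. Moreover g is an integrable g^ρ-module with finite multiplicities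 under the adjoint action. -/
attribute [local instance] Classical.propDecidable

noncomputable section

/-! ### Graded pieces of a Lie algebra with triangular generators -/

namespace KMG

open Module

section EigenspaceSum

variable {V : Type*} [AddCommGroup V] [Module ℂ V]

/-- An eigenvector lying in a sum of subspaces of eigenspaces, one for each integer, lies in the
summand of its own eigenvalue. -/
lemma mem_of_mem_iSup_of_mem_eigenspace (D : End ℂ V) (W : ℤ → Submodule ℂ V)
    (hW : ∀ n, W n ≤ D.eigenspace (n : ℂ)) {n : ℤ} {x : V} (hx : x ∈ ⨆ k, W k)
    (hD : x ∈ D.eigenspace (n : ℂ)) : x ∈ W n := by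
  have hsplit : (⨆ k, W k) = W n ⊔ ⨆ (k) (_ : k ≠ n), W k := by
    apply le_antisymm
    · refine iSup_le fun k => ?_
      by_cases hk : k = n
      · subst hk; exact le_sup_left
      · exact le_sup_of_le_right (le_iSup₂_of_le k hk le_rfl)
    · exact sup_le (le_iSup W n) (iSup₂_le fun k _ => le_iSup W k)
  rw [hsplit] at hx
  obtain ⟨u, hu, v, hv, rfl⟩ := Submodule.mem_sup.mp hx
  have hvD : v ∈ D.eigenspace (n : ℂ) := by
    simpa using Submodule.sub_mem _ hD (hW n hu)
  have hle : (⨆ (k) (_ : k ≠ n), W k) ≤ ⨆ (c : ℂ) (_ : c ≠ n), D.eigenspace c :=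
    iSup₂_le fun k hk => (hW k).trans
      (le_iSup₂_of_le (f := fun (c : ℂ) (_ : c ≠ n) => D.eigenspace c) (k : ℂ)
        (by exact_mod_cast hk) le_rfl)
  have hv0 : v = 0 :=
    Submodule.disjoint_def.mp (D.eigenspaces_iSupIndep (n : ℂ)) v hvD (hle hv)
  simpa [hv0] using hu

/-- Eigenspaces of a sum of finite dimensional subspaces of eigenspaces, one for each integer,
are finite dimensional. -/
lemma finiteDimensional_eigenspace_of_iSup_eq_top (D : End ℂ V) (W : ℤ → Submodule ℂ V)
    (hW : ∀ n, W n ≤ D.eigenspace (n : ℂ)) (htop : ⨆ k, W k = ⊤)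
    (hfin : ∀ n, FiniteDimensional ℂ (W n)) (c : ℂ) :
    FiniteDimensional ℂ (D.eigenspace c) := by
  by_cases hc : ∃ n : ℤ, (n : ℂ) = c
  · obtain ⟨n, rfl⟩ := hc
    have hle : D.eigenspace (n : ℂ) ≤ W n := fun x hx =>
      mem_of_mem_iSup_of_mem_eigenspace D W hW (htop ▸ Submodule.mem_top) hx
    have := hfin n
    exact Submodule.finiteDimensional_of_le hle
  · have hle : (⊤ : Submodule ℂ V) ≤ ⨆ (b : ℂ) (_ : b ≠ c), D.eigenspace b := by
      rw [← htop]
      exact iSup_le fun n => (hW n).trans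
        (le_iSup₂_of_le (f := fun (b : ℂ) (_ : b ≠ c) => D.eigenspace b) (n : ℂ)
          (fun h => hc ⟨n, h⟩) le_rfl)
    have hbot : D.eigenspace c = ⊥ := by
      rw [Submodule.eq_bot_iff]
      exact fun x hx => Submodule.disjoint_def.mp (D.eigenspaces_iSupIndep c) x hx
        (hle Submodule.mem_top)
    rw [hbot]
    infer_instance

end EigenspaceSum

section CommutingSum

variable {V : Type*} [AddCommGroup V] [Module ℂ V]

lemma add_pow_apply_eq_zero {D E : End ℂ V} (h : Commute D E) {m n : ℕ} {v : V}
    (hD : (D ^ (m + 1)) v = 0) (hE : (E ^ (n + 1)) v = 0) :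
    ((D + E) ^ (m + n + 1)) v = 0 := by
  rw [h.add_pow', LinearMap.sum_apply]
  refine Finset.sum_eq_zero fun p hp => ?_
  rw [Finset.HasAntidiagonal.mem_antidiagonal] at hp
  rw [LinearMap.smul_apply]
  obtain hle | hle : m + 1 ≤ p.1 ∨ n + 1 ≤ p.2 := by omega
  · rw [(h.pow_pow p.1 p.2).eq, Module.End.mul_apply, Module.End.pow_map_zero_of_le hle hD,
      map_zero, smul_zero]
  · rw [Module.End.mul_apply, Module.End.pow_map_zero_of_le hle hE, map_zero, smul_zero]

lemma sum_pow_apply_eq_zero {ι : Type*} (D : ι → End ℂ V) (m : ι → ℕ) (v : V) (s : Finset ι)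
    (hc : ∀ i ∈ s, ∀ j ∈ s, Commute (D i) (D j)) (h : ∀ i ∈ s, (D i ^ (m i + 1)) v = 0) :
    ((∑ i ∈ s, D i) ^ (∑ i ∈ s, m i + 1)) v = 0 := by
  classical
  induction s using Finset.induction_on with
  | empty => simp
  | insert i s hi ih =>
    rw [Finset.sum_insert hi, Finset.sum_insert hi]
    refine add_pow_apply_eq_zero ?_ (h i (Finset.mem_insert_self i s)) (ih ?_ ?_)
    · exact Commute.sum_right _ _ _ fun j hj =>
        hc i (Finset.mem_insert_self i s) j (Finset.mem_insert_of_mem hj)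
    · exact fun j hj k hk =>
        hc j (Finset.mem_insert_of_mem hj) k (Finset.mem_insert_of_mem hk)
    · exact fun j hj => h j (Finset.mem_insert_of_mem hj)

end CommutingSum

section Triangular

variable {L : Type*} [LieRing L] [LieAlgebra ℂ L] {J : Type*}

/-- A subspace containing a set and stable under the adjoint action of its elements contains the
Lie subalgebra it generates. -/
lemma lieSpan_le_of_stable (s : Set L) (T : Submodule ℂ L) (hs : s ⊆ T)
    (hstab : ∀ z ∈ s, ∀ u ∈ T, ⁅z, u⁆ ∈ T) {x : L}
    (hx : x ∈ LieSubalgebra.lieSpan ℂ L s) : x ∈ T := by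
  suffices h : x ∈ T ∧ ∀ u ∈ T, ⁅x, u⁆ ∈ T from h.1
  induction hx using LieSubalgebra.lieSpan_induction with
  | mem x h => exact ⟨hs h, hstab x h⟩
  | zero => exact ⟨T.zero_mem, fun u _ => by simp⟩
  | add x y _ _ hx hy =>
    exact ⟨T.add_mem hx.1 hy.1, fun u hu => by
      rw [add_lie]; exact T.add_mem (hx.2 u hu) (hy.2 u hu)⟩
  | smul c x _ hx =>
    exact ⟨T.smul_mem c hx.1, fun u hu => by rw [smul_lie]; exact T.smul_mem c (hx.2 u hu)⟩
  | lie x y _ _ hx hy =>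
    exact ⟨hx.2 y hy.1, fun u hu => by
      rw [lie_lie]; exact T.sub_mem (hx.2 _ (hy.2 u hu)) (hy.2 _ (hx.2 u hu))⟩

/-- The span of the iterated brackets of length `n + 1` in the elements `x j`. -/
def iterBracket (x : J → L) : ℕ → Submodule ℂ L
  | 0 => Submodule.span ℂ (Set.range x)
  | n + 1 => ⨆ j, (iterBracket x n).map (LieAlgebra.ad ℂ L (x j))

lemma mem_iterBracket_zero (x : J → L) (j : J) : x j ∈ iterBracket x 0 :=
  Submodule.subset_span (Set.mem_range_self j)

lemma lie_mem_iterBracket_succ (x : J → L) (j : J) {n : ℕ} {u : L} (hu : u ∈ iterBracket x n) :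
    ⁅x j, u⁆ ∈ iterBracket x (n + 1) :=
  Submodule.mem_iSup_of_mem j ⟨u, hu, rfl⟩

lemma iterBracket_zero_induction {x : J → L} {T : Submodule ℂ L} (h : ∀ j, x j ∈ T) :
    iterBracket x 0 ≤ T :=
  Submodule.span_le.mpr (by rintro _ ⟨j, rfl⟩; exact h j)

lemma iterBracket_succ_le {x : J → L} {n : ℕ} {T : Submodule ℂ L}
    (h : ∀ j, ∀ u ∈ iterBracket x n, ⁅x j, u⁆ ∈ T) : iterBracket x (n + 1) ≤ T :=
  iSup_le fun j => by rintro _ ⟨u, hu, rfl⟩; exact h j u hu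

lemma finiteDimensional_iterBracket [Finite J] (x : J → L) (n : ℕ) :
    FiniteDimensional ℂ (iterBracket x n) := by
  induction n with
  | zero => exact FiniteDimensional.span_of_finite ℂ (Set.finite_range x)
  | succ n ih =>
    have := ih
    exact Submodule.finiteDimensional_iSup _

lemma lie_mem_iterBracket_of_weight {x : J → L} {h : L} (hx : ∀ j, ∃ c : ℂ, ⁅h, x j⁆ = c • x j)
    (n : ℕ) : ∀ u ∈ iterBracket x n, ⁅h, u⁆ ∈ iterBracket x n := by
  induction n with
  | zero =>
    refine iterBracket_zero_induction (T := (iterBracket x 0).comap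
      (LieAlgebra.ad ℂ L h)) fun j => ?_
    obtain ⟨c, hc⟩ := hx j
    rw [Submodule.mem_comap, LieAlgebra.ad_apply, hc]
    exact Submodule.smul_mem _ _ (mem_iterBracket_zero x j)
  | succ n ih =>
    refine iterBracket_succ_le (T := (iterBracket x (n + 1)).comap
      (LieAlgebra.ad ℂ L h)) fun j u hu => ?_
    obtain ⟨c, hc⟩ := hx j
    rw [Submodule.mem_comap, LieAlgebra.ad_apply, leibniz_lie, hc, smul_lie]
    exact Submodule.add_mem _ (Submodule.smul_mem _ _ (lie_mem_iterBracket_succ x j hu))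
      (lie_mem_iterBracket_succ x j (ih u hu))

lemma iterBracket_le_eigenspace {x : J → L} {d : L} {c : ℂ} (hx : ∀ j, ⁅d, x j⁆ = c • x j)
    (n : ℕ) : iterBracket x n ≤ End.eigenspace (LieAlgebra.ad ℂ L d) ((n + 1 : ℕ) * c) := by
  induction n with
  | zero =>
    refine iterBracket_zero_induction fun j => ?_
    rw [End.mem_eigenspace_iff, LieAlgebra.ad_apply, hx]
    simp
  | succ n ih =>
    refine iterBracket_succ_le fun j u hu => ?_
    have hu' := End.mem_eigenspace_iff.mp (ih hu)
    rw [LieAlgebra.ad_apply] at hu'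
    rw [End.mem_eigenspace_iff, LieAlgebra.ad_apply, leibniz_lie, hx, hu', smul_lie, lie_smul,
      ← add_smul]
    congr 1
    push_cast
    ring

variable (H : Submodule ℂ L) (x y : J → L)

/-- The graded pieces of the Lie algebra generated by `H`, in degree `0`, by the `x j`, in degree
`1`, and by the `y j`, in degree `-1`. -/
def gradedPiece : ℤ → Submodule ℂ L
  | Int.ofNat 0 => H
  | Int.ofNat (n + 1) => iterBracket x n
  | Int.negSucc n => iterBracket y n

variable {H x y}

lemma mem_iSup_gradedPiece_zero {u : L} (hu : u ∈ H) : u ∈ ⨆ n, gradedPiece H x y n :=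
  Submodule.mem_iSup_of_mem (Int.ofNat 0) hu

lemma mem_iSup_gradedPiece_pos {n : ℕ} {u : L} (hu : u ∈ iterBracket x n) :
    u ∈ ⨆ n, gradedPiece H x y n :=
  Submodule.mem_iSup_of_mem (Int.ofNat (n + 1)) hu

lemma mem_iSup_gradedPiece_neg {n : ℕ} {u : L} (hu : u ∈ iterBracket y n) :
    u ∈ ⨆ n, gradedPiece H x y n :=
  Submodule.mem_iSup_of_mem (Int.negSucc n) hu

lemma iSup_gradedPiece_le {T : Submodule ℂ L} (h0 : ∀ u ∈ H, u ∈ T)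
    (hp : ∀ n, ∀ u ∈ iterBracket x n, u ∈ T) (hn : ∀ n, ∀ u ∈ iterBracket y n, u ∈ T) :
    ∀ u ∈ ⨆ n, gradedPiece H x y n, u ∈ T := by
  have : (⨆ n, gradedPiece H x y n) ≤ T := by
    refine iSup_le fun n => ?_
    match n with
    | Int.ofNat 0 => exact h0
    | Int.ofNat (n + 1) => exact hp n
    | Int.negSucc n => exact hn n
  exact this

/-- Bracketing with some `y i` lowers the degree in the part generated by the `x j`. -/
lemma lie_mem_of_lowering (hx : ∀ h ∈ H, ∀ j, ∃ c : ℂ, ⁅h, x j⁆ = c • x j)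
    (hyx : ∀ i j, ⁅y i, x j⁆ ∈ H) (i : J) (n : ℕ) :
    ∀ u ∈ iterBracket x (n + 1), ⁅y i, u⁆ ∈ iterBracket x n := by
  have key : ∀ n, ∀ u ∈ iterBracket x n, (n = 0 → ⁅y i, u⁆ ∈ H) ∧
      ∀ m, n = m + 1 → ⁅y i, u⁆ ∈ iterBracket x m := by
    intro n
    induction n with
    | zero =>
      intro u hu
      refine ⟨fun _ => ?_, fun m hm => by omega⟩
      exact iterBracket_zero_induction (T := H.comap (LieAlgebra.ad ℂ L (y i)))
        (fun j => hyx i j) hu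
    | succ n ih =>
      intro u hu
      refine ⟨fun h => by omega, fun m hm => ?_⟩
      obtain rfl : n = m := by omega
      refine iterBracket_succ_le (T := (iterBracket x n).comap
        (LieAlgebra.ad ℂ L (y i))) (fun j v hv => ?_) hu
      rw [Submodule.mem_comap, LieAlgebra.ad_apply, leibniz_lie]
      refine Submodule.add_mem _
        (lie_mem_iterBracket_of_weight (hx _ (hyx i j)) n v hv) ?_
      cases n with
      | zero =>
        obtain ⟨c, hc⟩ := hx _ ((ih v hv).1 rfl) j
        rw [← lie_skew, hc]
        exact Submodule.neg_mem _ (Submodule.smul_mem _ _ (mem_iterBracket_zero x j))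
      | succ k => exact lie_mem_iterBracket_succ x j ((ih v hv).2 k rfl)
  exact fun u hu => (key (n + 1) u hu).2 n rfl

lemma lieSpan_le_iSup_gradedPiece (hab : ∀ h ∈ H, ∀ h' ∈ H, ⁅h, h'⁆ = 0)
    (hx : ∀ h ∈ H, ∀ j, ∃ c : ℂ, ⁅h, x j⁆ = c • x j)
    (hy : ∀ h ∈ H, ∀ j, ∃ c : ℂ, ⁅h, y j⁆ = c • y j)
    (hxy : ∀ i j, ⁅x i, y j⁆ ∈ H) {u : L}
    (hu : u ∈ LieSubalgebra.lieSpan ℂ L ((H : Set L) ∪ Set.range x ∪ Set.range y)) :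
    u ∈ ⨆ n, gradedPiece H x y n := by
  have hyx : ∀ i j, ⁅y i, x j⁆ ∈ H := fun i j => by
    rw [← lie_skew]; exact H.neg_mem (hxy j i)
  have hcart : ∀ {z : J → L}, (∀ h ∈ H, ∀ j, ∃ c : ℂ, ⁅h, z j⁆ = c • z j) → ∀ j, ∀ h ∈ H,
      ⁅z j, h⁆ ∈ iterBracket z 0 := by
    intro z hz j h hh
    obtain ⟨c, hc⟩ := hz h hh j
    rw [← lie_skew, hc]
    exact Submodule.neg_mem _ (Submodule.smul_mem _ _ (mem_iterBracket_zero z j))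
  refine lieSpan_le_of_stable _ _ ?_ ?_ hu
  · rintro z ((hz | ⟨j, rfl⟩) | ⟨j, rfl⟩)
    · exact mem_iSup_gradedPiece_zero hz
    · exact mem_iSup_gradedPiece_pos (mem_iterBracket_zero x j)
    · exact mem_iSup_gradedPiece_neg (mem_iterBracket_zero y j)
  · rintro z ((hz | ⟨j, rfl⟩) | ⟨j, rfl⟩)
    · refine iSup_gradedPiece_le (T := (⨆ n, gradedPiece H x y n).comap
        (LieAlgebra.ad ℂ L z)) (fun u hu => ?_) (fun n u hu => ?_) (fun n u hu => ?_)
      · rw [Submodule.mem_comap, LieAlgebra.ad_apply, hab z hz u hu]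
        exact Submodule.zero_mem _
      · exact mem_iSup_gradedPiece_pos (lie_mem_iterBracket_of_weight (hx z hz) n u hu)
      · exact mem_iSup_gradedPiece_neg (lie_mem_iterBracket_of_weight (hy z hz) n u hu)
    · refine iSup_gradedPiece_le (T := (⨆ n, gradedPiece H x y n).comap
        (LieAlgebra.ad ℂ L (x j))) (fun u hu => ?_) (fun n u hu => ?_)
        (fun n u hu => ?_)
      · exact mem_iSup_gradedPiece_pos (hcart hx j u hu)
      · exact mem_iSup_gradedPiece_pos (lie_mem_iterBracket_succ x j hu)
      · cases n with
        | zero =>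
          exact mem_iSup_gradedPiece_zero (iterBracket_zero_induction
            (T := H.comap (LieAlgebra.ad ℂ L (x j))) (fun k => hxy j k) hu)
        | succ n => exact mem_iSup_gradedPiece_neg (lie_mem_of_lowering hy hxy j n u hu)
    · refine iSup_gradedPiece_le (T := (⨆ n, gradedPiece H x y n).comap
        (LieAlgebra.ad ℂ L (y j))) (fun u hu => ?_) (fun n u hu => ?_)
        (fun n u hu => ?_)
      · exact mem_iSup_gradedPiece_neg (hcart hy j u hu)
      · cases n with
        | zero =>
          exact mem_iSup_gradedPiece_zero (iterBracket_zero_induction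
            (T := H.comap (LieAlgebra.ad ℂ L (y j))) (fun k => hyx j k) hu)
        | succ n => exact mem_iSup_gradedPiece_pos (lie_mem_of_lowering hx hyx j n u hu)
      · exact mem_iSup_gradedPiece_neg (lie_mem_iterBracket_succ y j hu)

lemma gradedPiece_le_eigenspace {d : L} (hd : ∀ h ∈ H, ⁅d, h⁆ = 0) (hx : ∀ j, ⁅d, x j⁆ = x j)
    (hy : ∀ j, ⁅d, y j⁆ = -y j) (n : ℤ) :
    gradedPiece H x y n ≤ End.eigenspace (LieAlgebra.ad ℂ L d) (n : ℂ) := by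
  match n with
  | Int.ofNat 0 =>
    intro u hu
    rw [End.mem_eigenspace_iff, LieAlgebra.ad_apply, hd u hu]
    simp
  | Int.ofNat (n + 1) =>
    have := iterBracket_le_eigenspace (c := 1) (x := x) (d := d) (by simpa using hx) n
    simpa [gradedPiece] using this
  | Int.negSucc n =>
    have := iterBracket_le_eigenspace (c := -1) (x := y) (d := d) (by simpa using hy) n
    rw [mul_neg_one] at this
    simpa [gradedPiece] using this

lemma finiteDimensional_gradedPiece [Finite J] [FiniteDimensional ℂ H] (n : ℤ) :
    FiniteDimensional ℂ (gradedPiece H x y n) := by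
  match n with
  | Int.ofNat 0 => assumption
  | Int.ofNat (n + 1) => exact finiteDimensional_iterBracket x n
  | Int.negSucc n => exact finiteDimensional_iterBracket y n

end Triangular

section FiberSums

variable {I S M : Type*} [Fintype I] [DecidableEq S] [AddCommMonoid M]

lemma finsum_fiber_eq_sum (ρ : I → S) (s : S) (f : I → M) :
    ∑ᶠ k ∈ {k | ρ k = s}, f k = ∑ k ∈ Finset.univ.filter (fun k => ρ k = s), f k := by
  rw [finsum_mem_eq_finite_toFinset_sum _ (Set.toFinite _)]
  congr 1
  ext k
  simp

end FiberSums

/-- Sums over the (nonempty) fibers of a map of a linearly independent family are linearly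
independent. -/
lemma linearIndependent_fiber_sum {I S V : Type*} [Fintype I] [DecidableEq S] [AddCommGroup V] [Module ℂ V]
    {v : I → V} (hv : LinearIndependent ℂ v) {ρ : I → S} (hρ : Function.Surjective ρ) :
    LinearIndependent ℂ (fun s => ∑ k ∈ Finset.univ.filter (fun k => ρ k = s), v k) := by
  have := Fintype.ofSurjective ρ hρ
  rw [Fintype.linearIndependent_iff] at hv ⊢
  intro c hc s
  obtain ⟨i, rfl⟩ := hρ s
  refine hv (fun k => c (ρ k)) ?_ i
  rw [← hc, ← Finset.sum_fiberwise (s := Finset.univ) (g := ρ)]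
  refine Finset.sum_congr rfl fun t _ => ?_
  rw [Finset.smul_sum]
  refine Finset.sum_congr rfl fun k hk => ?_
  rw [(Finset.mem_filter.mp hk).2]

section WeightSpaces

variable {L : Type*} [LieRing L] [LieAlgebra ℂ L] {V : Type*} [AddCommGroup V] [Module ℂ V]

lemma lie_mem_wtSpaceι {ι : V →ₗ[ℂ] L} {χ ψ : Dual ℂ V} {x y : L} (hx : x ∈ wtSpaceι ι χ)
    (hy : y ∈ wtSpaceι ι ψ) : ⁅x, y⁆ ∈ wtSpaceι ι (χ + ψ) := by
  intro v
  rw [leibniz_lie, hx v, hy v, smul_lie, lie_smul, LinearMap.add_apply, add_smul]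

lemma lie_mem_iSup_wtSpaceι {ι : V →ₗ[ℂ] L} {x y : L} (hx : x ∈ ⨆ χ, wtSpaceι ι χ)
    (hy : y ∈ ⨆ χ, wtSpaceι ι χ) : ⁅x, y⁆ ∈ ⨆ χ, wtSpaceι ι χ := by
  induction hx using Submodule.iSup_induction' with
  | mem χ x hx =>
    induction hy using Submodule.iSup_induction' with
    | mem ψ y hy => exact Submodule.mem_iSup_of_mem (χ + ψ) (lie_mem_wtSpaceι hx hy)
    | zero => simp
    | add y z _ _ hy hz => rw [lie_add]; exact Submodule.add_mem _ hy hz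
  | zero => simp
  | add x z _ _ hx hz => rw [add_lie]; exact Submodule.add_mem _ hx hz

end WeightSpaces

section KacMoody

variable {I : Type*} [Fintype I] [DecidableEq I] {A : Matrix I I ℤ}
variable {g : Type*} [LieRing g] [LieAlgebra ℂ g]

/-- Exchanging the positive and negative Chevalley generators of a Kac-Moody algebra. -/
def KacMoodyAlgebra.flip (G : KacMoodyAlgebra A g) : KacMoodyAlgebra A g where
  H := G.H
  root := -G.root
  coroot := -G.coroot
  e := G.f
  f := G.e
  findimH := G.findimH
  finrankH := G.finrankH
  indepRoot := G.indepRoot.neg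
  indepCoroot := G.indepCoroot.neg
  pairing i j := by simpa using G.pairing i j
  abelian := G.abelian
  lie_e x i := by simpa using G.lie_f x i
  lie_f x i := by simpa using G.lie_e x i
  e_f i j := by
    rw [← lie_skew, G.e_f]
    by_cases h : i = j
    · subst h; simp
    · rw [if_neg h, if_neg (Ne.symm h), neg_zero]
  serre_e := G.serre_f
  serre_f := G.serre_e
  generates := by
    rw [Set.union_right_comm]
    exact G.generates
  weight_decomp := G.weight_decomp
  zero_weight := G.zero_weight

namespace KacMoodyAlgebra

variable (G : KacMoodyAlgebra A g)

lemma lie_e_f_mem (i j : I) : ⁅G.e i, G.f j⁆ ∈ G.H := by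
  rw [G.e_f]
  split_ifs
  · exact (G.coroot i).2
  · exact G.H.zero_mem

/-- The positive Chevalley generators of a Kac-Moody algebra are locally ad-nilpotent. -/
lemma engel_e (i : I) : LieSubalgebra.engel ℂ (G.e i) = ⊤ := by
  have of_lie : ∀ z, ⁅G.e i, z⁆ ∈ LieSubalgebra.engel ℂ (G.e i) →
      z ∈ LieSubalgebra.engel ℂ (G.e i) := by
    intro z hz
    obtain ⟨n, hn⟩ := (LieSubalgebra.mem_engel_iff _ _ _).mp hz
    exact (LieSubalgebra.mem_engel_iff _ _ _).mpr ⟨n + 1, by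
      rw [pow_succ, Module.End.mul_apply]; exact hn⟩
  have hH : ∀ h ∈ G.H, h ∈ LieSubalgebra.engel ℂ (G.e i) := by
    intro h hh
    apply of_lie
    rw [← lie_skew, G.lie_e ⟨h, hh⟩ i]
    exact neg_mem (LieSubalgebra.smul_mem _ _ (LieSubalgebra.self_mem_engel ℂ _))
  rw [eq_top_iff, ← G.generates, LieSubalgebra.lieSpan_le]
  rintro z ((hz | ⟨j, rfl⟩) | ⟨j, rfl⟩)
  · exact hH z hz
  · by_cases hij : i = j
    · subst hij; exact LieSubalgebra.self_mem_engel ℂ _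
    · exact (LieSubalgebra.mem_engel_iff _ _ _).mpr ⟨_, G.serre_e i j hij⟩
  · exact of_lie _ (hH _ (G.lie_e_f_mem i j))

lemma ad_e_commute {i j : I} (h : i ≠ j → A i j = 0) :
    Commute (LieAlgebra.ad ℂ g (G.e i)) (LieAlgebra.ad ℂ g (G.e j)) := by
  by_cases hij : i = j
  · subst hij; exact Commute.refl _
  · have h0 := G.serre_e i j hij
    rw [h hij] at h0
    have h1 : ⁅G.e i, G.e j⁆ = 0 := by simpa using h0
    refine LinearMap.ext fun z => ?_
    simp only [Module.End.mul_apply, LieAlgebra.ad_apply]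
    rw [leibniz_lie, h1, zero_lie, zero_add]

/-- There is an element of height one in any subspace of the Cartan subalgebra on which the simple
roots restrict to a linearly independent family. -/
lemma exists_root_eq_one {S : Type*} {ρ : I → S} {a : Submodule ℂ G.H} {γ : S → Dual ℂ a}
    (hγ : ∀ i : I, γ (ρ i) = (G.root i).comp a.subtype) (hindep : LinearIndependent ℂ γ) :
    ∃ d : a, (∀ s, γ s d = 1) ∧ ∀ i, G.root i (d : G.H) = 1 := by
  have := G.findimH
  obtain ⟨F, hF⟩ := Module.exists_dual_forall_apply_eq_one
    hindep.linearIndepOn_univ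
  obtain ⟨d, rfl⟩ := (Module.evalEquiv ℂ a).surjective F
  refine ⟨d, fun s => by simpa using hF s (Set.mem_univ s), fun i => ?_⟩
  have := hF (ρ i) (Set.mem_univ _)
  rw [hγ] at this
  simpa using this

end KacMoodyAlgebra

section Quotient

variable {S : Type*}

variable [DecidableEq S]

lemma Xbar_eq_sum (G : KacMoodyAlgebra A g) (ρ : I → S) (s : S) :
    Xbar G ρ s = ∑ k ∈ Finset.univ.filter (fun k => ρ k = s), G.e k :=
  finsum_fiber_eq_sum ρ s G.e

lemma Ybar_eq_sum (G : KacMoodyAlgebra A g) (ρ : I → S) (s : S) :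
    Ybar G ρ s = ∑ k ∈ Finset.univ.filter (fun k => ρ k = s), G.f k :=
  finsum_fiber_eq_sum ρ s G.f

lemma gammaV_eq_sum (G : KacMoodyAlgebra A g) (ρ : I → S) (s : S) :
    gammaV G ρ s = ∑ k ∈ Finset.univ.filter (fun k => ρ k = s), G.coroot k :=
  finsum_fiber_eq_sum ρ s G.coroot

variable (G : KacMoodyAlgebra A g) {ρ : I → S}

lemma ad_Xbar (s : S) : LieAlgebra.ad ℂ g (Xbar G ρ s) =
    ∑ k ∈ Finset.univ.filter (fun k => ρ k = s), LieAlgebra.ad ℂ g (G.e k) := by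
  rw [Xbar_eq_sum, map_sum]

lemma ad_e_commute_of_fiber (hadm : AdmissibleQuotient A ρ) (s : S) :
    ∀ i ∈ Finset.univ.filter (fun k => ρ k = s), ∀ j ∈ Finset.univ.filter (fun k => ρ k = s),
      Commute (LieAlgebra.ad ℂ g (G.e i)) (LieAlgebra.ad ℂ g (G.e j)) := by
  intro i hi j hj
  rw [Finset.mem_filter] at hi hj
  exact G.ad_e_commute fun h => hadm.2.1 i j h (hi.2.trans hj.2.symm)

lemma Xbar_locally_nilpotent (hadm : AdmissibleQuotient A ρ) (s : S) (z : g) :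
    ∃ n : ℕ, ((LieAlgebra.ad ℂ g (Xbar G ρ s)) ^ n) z = 0 := by
  have h : ∀ i, ∃ n : ℕ, ((LieAlgebra.ad ℂ g (G.e i)) ^ n) z = 0 := fun i =>
    (LieSubalgebra.mem_engel_iff ℂ _ _).mp (by rw [G.engel_e i]; exact LieSubalgebra.mem_top _)
  choose m hm using h
  refine ⟨∑ i ∈ Finset.univ.filter (fun k => ρ k = s), m i + 1, ?_⟩
  rw [ad_Xbar]
  exact sum_pow_apply_eq_zero _ m z _ (ad_e_commute_of_fiber G hadm s)
    fun i _ => Module.End.pow_map_zero_of_le (Nat.le_succ _) (hm i)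

lemma Xbar_serre (hGCM : IsGCM A) (hadm : AdmissibleQuotient A ρ) {Abar : Matrix S S ℤ}
    (hoff : ∀ s t, s ≠ t → ∀ j, ρ j = t → Abar s t = ∑ᶠ i ∈ {i | ρ i = s}, A i j)
    {s t : S} (hst : s ≠ t) :
    ((LieAlgebra.ad ℂ g (Xbar G ρ s)) ^ (1 - Abar s t).toNat) (Xbar G ρ t) = 0 := by
  rw [Xbar_eq_sum G ρ t, map_sum]
  refine Finset.sum_eq_zero fun j hj => ?_
  rw [Finset.mem_filter] at hj
  have hne : ∀ i ∈ Finset.univ.filter (fun k => ρ k = s), i ≠ j := by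
    rintro i hi rfl
    exact hst ((Finset.mem_filter.mp hi).2.symm.trans hj.2)
  have hsum : (1 - Abar s t).toNat =
      ∑ i ∈ Finset.univ.filter (fun k => ρ k = s), (-A i j).toNat + 1 := by
    zify
    rw [hoff s t hst j hj.2, finsum_fiber_eq_sum]
    have h1 : ∀ i ∈ Finset.univ.filter (fun k => ρ k = s), max (-A i j) 0 = -A i j :=
      fun i hi => max_eq_left (by have := hGCM.2.1 i j (hne i hi); omega)
    have h2 : ∑ i ∈ Finset.univ.filter (fun k => ρ k = s), A i j ≤ 0 :=
      Finset.sum_nonpos fun i hi => hGCM.2.1 i j (hne i hi)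
    simp only [Int.ofNat_toNat]
    rw [Finset.sum_congr rfl h1, Finset.sum_neg_distrib, max_eq_left (by omega)]
    ring
  rw [hsum, ad_Xbar]
  refine sum_pow_apply_eq_zero _ _ _ _ (ad_e_commute_of_fiber G hadm s) fun i hi => ?_
  have h := G.serre_e i j (hne i hi)
  have hA := hGCM.2.1 i j (hne i hi)
  rwa [show (1 - A i j).toNat = (-A i j).toNat + 1 by omega] at h

lemma lie_Xbar_of_root_eq {x : G.H} {s : S} {c : ℂ} (h : ∀ k, ρ k = s → G.root k x = c) :
    ⁅(x : g), Xbar G ρ s⁆ = c • Xbar G ρ s := by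
  rw [Xbar_eq_sum, lie_sum, Finset.smul_sum]
  refine Finset.sum_congr rfl fun k hk => ?_
  rw [G.lie_e, h k (Finset.mem_filter.mp hk).2]

lemma lie_Ybar_of_root_eq {x : G.H} {s : S} {c : ℂ} (h : ∀ k, ρ k = s → G.root k x = c) :
    ⁅(x : g), Ybar G ρ s⁆ = -c • Ybar G ρ s := by
  rw [Ybar_eq_sum, lie_sum, Finset.smul_sum]
  refine Finset.sum_congr rfl fun k hk => ?_
  rw [G.lie_f, h k (Finset.mem_filter.mp hk).2]

lemma lie_Xbar_Ybar (s t : S) :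
    ⁅Xbar G ρ s, Ybar G ρ t⁆ = if t = s then (gammaV G ρ s : g) else 0 := by
  rw [Xbar_eq_sum, Ybar_eq_sum, gammaV_eq_sum, sum_lie_sum]
  simp only [G.e_f]
  split_ifs with hts
  · subst hts
    rw [AddSubmonoidClass.coe_finsetSum]
    refine Finset.sum_congr rfl fun k hk => ?_
    rw [Finset.sum_ite_eq' _ k, if_pos hk]
  · refine Finset.sum_eq_zero fun k hk => Finset.sum_eq_zero fun l hl => ?_
    rw [if_neg]
    rintro rfl
    exact hts ((Finset.mem_filter.mp hl).2.symm.trans (Finset.mem_filter.mp hk).2)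

end Quotient

section AssociatedStructure

variable {S : Type*} (G : KacMoodyAlgebra A g) {ρ : I → S} (a : Submodule ℂ G.H)

lemma cartan_mem_gRho (x : a) : ((x : G.H) : g) ∈ gRho G ρ a :=
  LieSubalgebra.subset_lieSpan (Or.inl (Or.inl ⟨x, x.2, rfl⟩))

lemma Xbar_mem_gRho (s : S) : Xbar G ρ s ∈ gRho G ρ a :=
  LieSubalgebra.subset_lieSpan (Or.inl (Or.inr ⟨s, rfl⟩))

lemma Ybar_mem_gRho (s : S) : Ybar G ρ s ∈ gRho G ρ a :=
  LieSubalgebra.subset_lieSpan (Or.inr ⟨s, rfl⟩)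

variable (ρ) in
/-- The inclusion of the subspace `a` of the Cartan subalgebra in `g^ρ`. -/
def cartanToGRho : a →ₗ[ℂ] gRho G ρ a :=
  LinearMap.codRestrict (gRho G ρ a).toSubmodule (G.H.subtype ∘ₗ a.subtype)
    (cartan_mem_gRho G a)

@[simp] lemma coe_cartanToGRho (x : a) : (cartanToGRho G ρ a x : g) = ((x : G.H) : g) := rfl

lemma cartanToGRho_injective : Function.Injective (cartanToGRho G ρ a) := by
  intro x y h
  exact Subtype.ext (Subtype.ext (congrArg (fun z : gRho G ρ a => (z : g)) h))

variable (ρ) in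
/-- The identification of `a` with the Cartan subalgebra of `g^ρ`. -/
def cartanEquiv : a ≃ₗ[ℂ] LinearMap.range (cartanToGRho G ρ a) :=
  LinearEquiv.ofInjective _ (cartanToGRho_injective G a)

@[simp] lemma coe_cartanEquiv (x : a) :
    ((cartanEquiv G ρ a x : gRho G ρ a) : g) = ((x : G.H) : g) := rfl

lemma iSup_wtSpaceι_subspace_eq_top (a : Submodule ℂ G.H) :
    ⨆ χ : Dual ℂ a, wtSpaceι (G.H.subtype ∘ₗ a.subtype) χ = ⊤ := by
  rw [eq_top_iff, ← G.weight_decomp]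
  exact iSup_le fun χ => le_iSup_of_le (χ.comp a.subtype) fun z hz v => hz v

variable {a} {γ : S → Dual ℂ a}

lemma root_eq_of_fiber (hγ : ∀ i : I, γ (ρ i) = (G.root i).comp a.subtype) (x : a) (s : S) (k : I)
    (hk : ρ k = s) : G.root k (x : G.H) = γ s x := by
  subst hk
  rw [hγ]
  rfl

/-- The weight spaces of a Kac-Moody algebra under `a` are finite dimensional. -/
lemma finiteDimensional_wtSpaceι_of_quotient
    (hγ : ∀ i : I, γ (ρ i) = (G.root i).comp a.subtype)
    (hindep : LinearIndependent ℂ γ) (χ : Dual ℂ a) :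
    FiniteDimensional ℂ (wtSpaceι (G.H.subtype ∘ₗ a.subtype) χ) := by
  have := G.findimH
  obtain ⟨d, -, hd⟩ := G.exists_root_eq_one hγ hindep
  have htop : ⨆ n, gradedPiece G.H G.e G.f n = ⊤ := by
    rw [eq_top_iff]
    intro z _
    refine lieSpan_le_iSup_gradedPiece (fun x hx y hy => G.abelian ⟨x, hx⟩ ⟨y, hy⟩)
      (fun x hx i => ⟨_, G.lie_e ⟨x, hx⟩ i⟩) (fun x hx i => ⟨_, G.lie_f ⟨x, hx⟩ i⟩)
      G.lie_e_f_mem (u := z) ?_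
    rw [G.generates]
    exact LieSubalgebra.mem_top z
  have hfin := finiteDimensional_eigenspace_of_iSup_eq_top
    (LieAlgebra.ad ℂ g ((d : G.H) : g)) (gradedPiece G.H G.e G.f)
    (gradedPiece_le_eigenspace (fun x hx => G.abelian d ⟨x, hx⟩)
      (fun i => by rw [G.lie_e, hd, one_smul]) (fun i => by rw [G.lie_f, hd, neg_one_smul]))
    htop finiteDimensional_gradedPiece (χ d)
  refine Submodule.finiteDimensional_of_le (S₂ := Module.End.eigenspace
    (LieAlgebra.ad ℂ g ((d : G.H) : g)) (χ d)) fun z hz => ?_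
  rw [Module.End.mem_eigenspace_iff]
  exact hz d

lemma coe_ad_pow {L : Type*} [LieRing L] [LieAlgebra ℂ L] (K : LieSubalgebra ℂ L) (x y : K)
    (n : ℕ) : (((LieAlgebra.ad ℂ K x ^ n) y : K) : L) = (LieAlgebra.ad ℂ L (x : L) ^ n) (y : L) := by
  induction n with
  | zero => rfl
  | succ n ih =>
    rw [pow_succ', pow_succ', Module.End.mul_apply, Module.End.mul_apply, ← ih]
    rfl

/-- The subalgebra `g^ρ` is generated, as a Lie algebra, by `a` and the `X̄_s`, `Ȳ_s`. -/
lemma lieSpan_generators_gRho :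
    LieSubalgebra.lieSpan ℂ (gRho G ρ a)
      ((LinearMap.range (cartanToGRho G ρ a) : Set (gRho G ρ a)) ∪
        Set.range (fun s => (⟨Xbar G ρ s, Xbar_mem_gRho G a s⟩ : gRho G ρ a)) ∪
        Set.range (fun s => (⟨Ybar G ρ s, Ybar_mem_gRho G a s⟩ : gRho G ρ a))) = ⊤ := by
  set K := LieSubalgebra.lieSpan ℂ (gRho G ρ a)
      ((LinearMap.range (cartanToGRho G ρ a) : Set (gRho G ρ a)) ∪
        Set.range (fun s => (⟨Xbar G ρ s, Xbar_mem_gRho G a s⟩ : gRho G ρ a)) ∪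
        Set.range (fun s => (⟨Ybar G ρ s, Ybar_mem_gRho G a s⟩ : gRho G ρ a)))
  have hle : gRho G ρ a ≤ K.map (gRho G ρ a).incl := by
    conv_lhs => rw [gRho]
    rw [LieSubalgebra.lieSpan_le]
    rintro z ((⟨x, hx, rfl⟩ | ⟨s, rfl⟩) | ⟨s, rfl⟩)
    · exact ⟨cartanToGRho G ρ a ⟨x, hx⟩,
        LieSubalgebra.subset_lieSpan (Or.inl (Or.inl ⟨⟨x, hx⟩, rfl⟩)), rfl⟩
    · exact ⟨⟨Xbar G ρ s, Xbar_mem_gRho G a s⟩,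
        LieSubalgebra.subset_lieSpan (Or.inl (Or.inr ⟨s, rfl⟩)), rfl⟩
    · exact ⟨⟨Ybar G ρ s, Ybar_mem_gRho G a s⟩,
        LieSubalgebra.subset_lieSpan (Or.inr ⟨s, rfl⟩), rfl⟩
  rw [eq_top_iff]
  intro z _
  obtain ⟨w, hw, hwz⟩ := hle z.2
  rwa [show z = w from Subtype.ext hwz.symm]

variable [DecidableEq S]

/-- The elements of `g^ρ` centralizing `a` are those of `a`. -/
lemma mem_cartan_of_lie_eq_zero (hav : ∀ s, gammaV G ρ s ∈ a)
    (hγ : ∀ i : I, γ (ρ i) = (G.root i).comp a.subtype) (hindep : LinearIndependent ℂ γ)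
    {z : g} (hz : z ∈ gRho G ρ a) (h0 : ∀ x : a, ⁅((x : G.H) : g), z⁆ = 0) :
    z ∈ a.map G.H.subtype := by
  obtain ⟨d, hd, -⟩ := G.exists_root_eq_one hγ hindep
  have hX : ∀ (x : a) s, ⁅((x : G.H) : g), Xbar G ρ s⁆ = γ s x • Xbar G ρ s := fun x s =>
    lie_Xbar_of_root_eq G (root_eq_of_fiber G hγ x s)
  have hY : ∀ (x : a) s, ⁅((x : G.H) : g), Ybar G ρ s⁆ = -γ s x • Ybar G ρ s := fun x s =>
    lie_Ybar_of_root_eq G (root_eq_of_fiber G hγ x s)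
  have hgr : z ∈ ⨆ n, gradedPiece (a.map G.H.subtype) (Xbar G ρ) (Ybar G ρ) n := by
    refine lieSpan_le_iSup_gradedPiece ?_ ?_ ?_ ?_ hz
    · rintro _ ⟨x, -, rfl⟩ _ ⟨y, -, rfl⟩
      exact G.abelian x y
    · rintro _ ⟨x, hx, rfl⟩ s
      exact ⟨_, hX ⟨x, hx⟩ s⟩
    · rintro _ ⟨x, hx, rfl⟩ s
      exact ⟨_, hY ⟨x, hx⟩ s⟩
    · intro s t
      rw [lie_Xbar_Ybar]
      split_ifs
      · exact ⟨_, hav s, rfl⟩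
      · exact Submodule.zero_mem _
  refine mem_of_mem_iSup_of_mem_eigenspace (n := 0) (LieAlgebra.ad ℂ g ((d : G.H) : g)) _
    (gradedPiece_le_eigenspace ?_ ?_ ?_) hgr ?_
  · rintro _ ⟨x, -, rfl⟩
    exact G.abelian d x
  · intro s; rw [hX, hd, one_smul]
  · intro s; rw [hY, hd, neg_one_smul]
  · rw [Module.End.mem_eigenspace_iff, LieAlgebra.ad_apply, h0]
    simp

variable [Fintype S]

/-- The Kac-Moody algebra structure on the subalgebra `g^ρ` attached to an admissible quotient. -/
def kacMoodyGRho (hGCM : IsGCM A) (hadm : AdmissibleQuotient A ρ)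
    {Abar : Matrix S S ℤ} (hdiag : ∀ s, Abar s s = 2)
    (hoff : ∀ s t, s ≠ t → ∀ j, ρ j = t → Abar s t = ∑ᶠ i ∈ {i | ρ i = s}, A i j)
    (hav : ∀ s, gammaV G ρ s ∈ a)
    (hγ : ∀ i : I, γ (ρ i) = (G.root i).comp a.subtype)
    (hindep : LinearIndependent ℂ γ) (hfd : FiniteDimensional ℂ a)
    (hdim : finrank ℂ a = 2 * Fintype.card S - (Abar.map ((↑) : ℤ → ℚ)).rank) :
    KacMoodyAlgebra Abar (gRho G ρ a) where
  H := LinearMap.range (cartanToGRho G ρ a)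
  root s := (γ s).comp (cartanEquiv G ρ a).symm.toLinearMap
  coroot s := cartanEquiv G ρ a ⟨gammaV G ρ s, hav s⟩
  e s := ⟨Xbar G ρ s, Xbar_mem_gRho G a s⟩
  f s := ⟨Ybar G ρ s, Ybar_mem_gRho G a s⟩
  findimH := inferInstance
  finrankH := by
    rw [← (cartanEquiv G ρ a).finrank_eq, hdim, gcmCorank]
    have := Matrix.rank_le_card_width (Abar.map ((↑) : ℤ → ℚ))
    omega
  indepRoot := hindep.map' (cartanEquiv G ρ a).symm.dualMap.toLinearMap (LinearEquiv.ker _)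
  indepCoroot := by
    have h := linearIndependent_fiber_sum G.indepCoroot hadm.1
    simp only [← gammaV_eq_sum] at h
    have h' : LinearIndependent ℂ (fun s => (⟨gammaV G ρ s, hav s⟩ : a)) :=
      LinearIndependent.of_comp a.subtype h
    exact h'.map' (cartanEquiv G ρ a).toLinearMap (LinearEquiv.ker _)
  pairing s t := by
    obtain ⟨j, rfl⟩ := hadm.1 t
    rw [LinearMap.comp_apply, LinearEquiv.coe_coe, LinearEquiv.symm_apply_apply, hγ]
    change G.root j (gammaV G ρ s) = _
    rw [gammaV_eq_sum, map_sum]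
    simp only [G.pairing]
    by_cases hs : s = ρ j
    · subst hs
      rw [hdiag, Finset.sum_eq_single_of_mem j (by simp), hGCM.1]
      intro i hi hij
      rw [hadm.2.1 i j hij (Finset.mem_filter.mp hi).2, Int.cast_zero]
    · rw [hoff s (ρ j) hs j rfl, finsum_fiber_eq_sum, Int.cast_sum]
  abelian := by
    rintro ⟨_, x, rfl⟩ ⟨_, y, rfl⟩
    exact Subtype.ext (G.abelian x y)
  lie_e x s := by
    obtain ⟨x, rfl⟩ := (cartanEquiv G ρ a).surjective x
    rw [LinearMap.comp_apply, LinearEquiv.coe_coe, LinearEquiv.symm_apply_apply]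
    exact Subtype.ext (lie_Xbar_of_root_eq G (root_eq_of_fiber G hγ x s))
  lie_f x s := by
    obtain ⟨x, rfl⟩ := (cartanEquiv G ρ a).surjective x
    rw [LinearMap.comp_apply, LinearEquiv.coe_coe, LinearEquiv.symm_apply_apply]
    exact Subtype.ext (lie_Ybar_of_root_eq G (root_eq_of_fiber G hγ x s))
  e_f s t := by
    apply Subtype.ext
    refine (lie_Xbar_Ybar G s t).trans ?_
    split_ifs <;> rfl
  serre_e s t hst := by
    apply Subtype.ext
    rw [coe_ad_pow]
    exact Xbar_serre G hGCM hadm hoff hst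
  serre_f s t hst := by
    apply Subtype.ext
    rw [coe_ad_pow]
    exact Xbar_serre G.flip hGCM hadm hoff hst
  generates := lieSpan_generators_gRho G
  weight_decomp := by
    set W := ⨆ χ, wtSpaceι (LinearMap.range (cartanToGRho G ρ a)).subtype χ
    rw [eq_top_iff]
    intro z _
    have hz : z ∈ (⊤ : LieSubalgebra ℂ (gRho G ρ a)) := LieSubalgebra.mem_top z
    rw [← lieSpan_generators_gRho G] at hz
    induction hz using LieSubalgebra.lieSpan_induction with
    | mem z hz =>
      rcases hz with (⟨x, rfl⟩ | ⟨s, rfl⟩) | ⟨s, rfl⟩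
      · refine Submodule.mem_iSup_of_mem 0 ?_
        rintro ⟨_, y, rfl⟩
        rw [LinearMap.zero_apply, zero_smul]
        exact Subtype.ext (G.abelian y x)
      · refine Submodule.mem_iSup_of_mem ((γ s).comp (cartanEquiv G ρ a).symm.toLinearMap) ?_
        intro x
        obtain ⟨x, rfl⟩ := (cartanEquiv G ρ a).surjective x
        rw [LinearMap.comp_apply, LinearEquiv.coe_coe, LinearEquiv.symm_apply_apply]
        exact Subtype.ext (lie_Xbar_of_root_eq G (root_eq_of_fiber G hγ x s))
      · refine Submodule.mem_iSup_of_mem (-(γ s).comp (cartanEquiv G ρ a).symm.toLinearMap) ?_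
        intro x
        obtain ⟨x, rfl⟩ := (cartanEquiv G ρ a).surjective x
        rw [LinearMap.neg_apply, LinearMap.comp_apply, LinearEquiv.coe_coe,
          LinearEquiv.symm_apply_apply]
        exact Subtype.ext (lie_Ybar_of_root_eq G (root_eq_of_fiber G hγ x s))
    | zero => exact Submodule.zero_mem _
    | add x y _ _ hx hy => exact Submodule.add_mem _ (hx trivial) (hy trivial)
    | smul c x _ hx => exact Submodule.smul_mem _ c (hx trivial)
    | lie x y _ _ hx hy => exact lie_mem_iSup_wtSpaceι (hx trivial) (hy trivial)
  zero_weight := by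
    apply le_antisymm
    · intro z hz
      obtain ⟨x, hx, hxz⟩ := mem_cartan_of_lie_eq_zero G hav hγ hindep z.2 fun x => by
        have h := hz (cartanEquiv G ρ a x)
        rw [LinearMap.zero_apply, zero_smul] at h
        exact congrArg (fun w : gRho G ρ a => (w : g)) h
      exact ⟨⟨x, hx⟩, Subtype.ext hxz⟩
    · rintro _ ⟨x, rfl⟩ ⟨_, y, rfl⟩
      rw [LinearMap.zero_apply, zero_smul]
      exact Subtype.ext (G.abelian y x)

end AssociatedStructure

end KacMoody

end KMG


open KMG

section Statement

attribute [local instance] Classical.propDecidable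

variable {I : Type*} [Fintype I] [DecidableEq I] {A : Matrix I I ℤ}
variable {g : Type*} [LieRing g] [LieAlgebra ℂ g]
variable {S : Type*} [Fintype S] [DecidableEq S]

theorem statement18
    (hGCM : IsGCM A) (hInd : Indecomposable A) (hSym : Symmetrizable A)
    (G : KacMoodyAlgebra A g)
    (ρ : I → S) (hadm : AdmissibleQuotient A ρ)
    (Abar : Matrix S S ℤ) (hdiag : ∀ s, Abar s s = 2)
    (hoff : ∀ s t, s ≠ t → ∀ j, ρ j = t → Abar s t = ∑ᶠ i ∈ {i | ρ i = s}, A i j)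
    (a : Submodule ℂ ↥G.H)
    (haG : ∀ x : ↥G.H, x ∈ a → ∀ k l, ρ k = ρ l → G.root k x = G.root l x)
    (hav : ∀ s, gammaV G ρ s ∈ a)
    (γ : S → Module.Dual ℂ ↥a)
    (hγ : ∀ i : I, γ (ρ i) = (G.root i).comp a.subtype)
    (hindep : LinearIndependent ℂ γ)
    (hfd : FiniteDimensional ℂ ↥a)
    (hdim : Module.finrank ℂ ↥a = 2 * Fintype.card S - (Abar.map ((↑) : ℤ → ℚ)).rank) :
    (∀ s t, s ≠ t →
        ((LieAlgebra.ad ℂ g (Xbar G ρ s)) ^ (1 - Abar s t).toNat) (Xbar G ρ t) = 0 ∧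
        ((LieAlgebra.ad ℂ g (Ybar G ρ s)) ^ (1 - Abar s t).toNat) (Ybar G ρ t) = 0) ∧
    (∃ Gρ : KacMoodyAlgebra Abar ↥(gRho G ρ a), IsAssocKMrho G ρ a Gρ) ∧
    (⨆ χ : Module.Dual ℂ ↥a, wtSpaceι (G.H.subtype ∘ₗ a.subtype) χ) = ⊤ ∧
    (∀ (s : S) (x : g), ∃ n : ℕ, ((LieAlgebra.ad ℂ g (Xbar G ρ s)) ^ n) x = 0) ∧
    (∀ (s : S) (x : g), ∃ n : ℕ, ((LieAlgebra.ad ℂ g (Ybar G ρ s)) ^ n) x = 0) ∧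
    (∀ χ : Module.Dual ℂ ↥a,
        FiniteDimensional ℂ ↥(wtSpaceι (G.H.subtype ∘ₗ a.subtype) χ)) := by
  refine ⟨fun s t hst => ⟨Xbar_serre G hGCM hadm hoff hst,
      Xbar_serre G.flip hGCM hadm hoff hst⟩,
    ⟨kacMoodyGRho G hGCM hadm hdiag hoff hav hγ hindep hfd hdim, ?_, fun _ => rfl,
      fun _ => rfl, fun _ => rfl⟩,
    iSup_wtSpaceι_subspace_eq_top G a, Xbar_locally_nilpotent G hadm,
    Xbar_locally_nilpotent G.flip hadm, finiteDimensional_wtSpaceι_of_quotient G hγ hindep⟩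
  ext z
  constructor
  · rintro ⟨_, ⟨x, rfl⟩, rfl⟩
    exact ⟨x, x.2, rfl⟩
  · rintro ⟨x, hx, rfl⟩
    exact ⟨cartanToGRho G ρ a ⟨x, hx⟩, ⟨⟨x, hx⟩, rfl⟩, rfl⟩

end Statement
end
end
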